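/- arXiv:math/0405290 — 14 statements merged into one kernel-verified Lean document; each statement's English description precedes it below -/
import Mathlib

section
/- Let r ∈ (0, +∞], let f be a convex function with values in ℝ ∪ {+∞} whose effective domain dom(f) := {y : f(y) < +∞} satisfies int[dom(f)] ⊆ (0, r) and r ∉ dom(f), and suppose f(0+) := lim_{y↓0} f(y) > 0. For constants k₁ ≥ 0, k₂ ≥ 0 define f^k(y) := f(y) − k₁·y + k₂ on dom(f). If there exist constants C > 0 and δ > 0 such that |q|·y ≤ C·f(y) for all y ∈ (0, δ) ∩ dom(f) and all q ∈ ∂f(y), then there exist constants C' > 0 and δ' > 0 such that |q − k₁|·y ≤ C'·f^k(y) for all y ∈ (0, δ') ∩ dom(f) and all q ∈ ∂f(y). (Note that ∂f^k(y) = {q − k₁ : q ∈ ∂f(y)}, so this says: the asymptotic elasticity condition AE_0(f) < ∞ implies AE_0(f^k) < ∞.) -/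
/-- Lemma 2.1(i) — `AE_0(f) < ∞` implies `AE_0(f^k) < ∞` when `f(0+) > 0`.
The convex function `f` with values in `ℝ ∪ {+∞}` is encoded by its (convex) effective
domain `D` together with its real values `f` on `D`.  The subdifferential of `f` at `y`
relative to `D` is the set of `q` such that `f z ≥ f y + q * (z - y)` for all `z ∈ D`. -/
theorem lemma_2_1_i (r : EReal) (hr : 0 < r) (D : Set ℝ) (f : ℝ → ℝ)
    (hconv : ConvexOn ℝ D f)
    (hdom : ∀ y ∈ interior D, 0 < y ∧ (y : EReal) < r)
    (hrD : ∀ y ∈ D, (y : EReal) ≠ r)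
    -- `f(0+) > 0`
    (hlim : ∃ ε > (0:ℝ), ∃ δ > (0:ℝ), ∀ y ∈ D, 0 < y → y < δ → ε ≤ f y)
    (k₁ k₂ : ℝ) (hk₁ : 0 ≤ k₁) (hk₂ : 0 ≤ k₂)
    -- `AE_0(f) < ∞`
    (hAE : ∃ C > (0:ℝ), ∃ δ > (0:ℝ), ∀ y ∈ D, 0 < y → y < δ →
      ∀ q : ℝ, (∀ z ∈ D, f y + q * (z - y) ≤ f z) → |q| * y ≤ C * f y) :
    -- `AE_0(f^k) < ∞`
    ∃ C' > (0:ℝ), ∃ δ' > (0:ℝ), ∀ y ∈ D, 0 < y → y < δ' →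
      ∀ q : ℝ, (∀ z ∈ D, f y + q * (z - y) ≤ f z) →
        |q - k₁| * y ≤ C' * (f y - k₁ * y + k₂) := by
  obtain ⟨ε, hε, δ₀, hδ₀, hf⟩ := hlim
  obtain ⟨C, hC, δ, hδ, hAE⟩ := hAE
  refine ⟨2 * C + 1, by positivity, min (min δ δ₀) (ε / (2 * (k₁ + 1))), by positivity, ?_⟩
  intro y hyD hy hyδ q hq
  rw [lt_min_iff, lt_min_iff, lt_div_iff₀ (by positivity)] at hyδ
  obtain ⟨⟨hyδ, hyδ₀⟩, hyε⟩ := hyδ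
  have hfy : ε ≤ f y := hf y hyD hy hyδ₀
  have hqy : |q| * y ≤ C * f y := hAE y hyD hy hyδ q hq
  have hky : k₁ * y ≤ f y / 2 := by linarith
  have habs : |q - k₁| ≤ |q| + k₁ := by
    simpa only [abs_of_nonneg hk₁] using abs_sub q k₁
  calc |q - k₁| * y ≤ (|q| + k₁) * y := by gcongr
    _ ≤ (2 * C + 1) * (f y / 2) := by linarith
    _ ≤ (2 * C + 1) * (f y - k₁ * y + k₂) := by gcongr; linarith
end

section
/- Let r ∈ (0, +∞], let f be a convex function with values in ℝ ∪ {+∞} whose effective domain dom(f) := {y : f(y) < +∞} satisfies int[dom(f)] ⊆ (0, r) and r ∉ dom(f). Suppose that f(r−) := lim_{y↑r} f(y) > 0 and that the subgradients of f blow up at r, i.e., for every M > 0 there exists y' < r such that every q ∈ ∂f(y) with y ∈ (y', r) ∩ dom(f) satisfies q ≥ M. For constants k₁ ≥ 0, k₂ ≥ 0 define f^k(y) := f(y) − k₁·y + k₂ on dom(f). If there exist constants C > 0 and y₀ < r such that |q|·y ≤ C·f(y) for all y ∈ (y₀, r) ∩ dom(f) and all q ∈ ∂f(y), then there exist constants C'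 > 0 and y₁ < r such that |q − k₁|·y ≤ C'·f^k(y) for all y ∈ (y₁, r) ∩ dom(f) and all q ∈ ∂f(y). (This says: the asymptotic elasticity condition AE_r(f) < ∞ implies AE_r(f^k) < ∞.) -/
/-- Lemma 2.1(ii) — `AE_r(f) < ∞` implies `AE_r(f^k) < ∞` when `f(r−) > 0`
and the subgradients of `f` blow up at `r`.  The convex function `f` with values in
`ℝ ∪ {+∞}` is encoded by its (convex) effective domain `D` together with its real values
`f` on `D`; `r ∈ (0, +∞]` is encoded as an extended real. -/
theorem lemma_2_1_ii (r : EReal) (hr : 0 < r) (D : Set ℝ) (f : ℝ → ℝ)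
    (hconv : ConvexOn ℝ D f)
    (hdom : ∀ y ∈ interior D, 0 < y ∧ (y : EReal) < r)
    (hrD : ∀ y ∈ D, (y : EReal) ≠ r)
    -- `f(r−) > 0`
    (hlim : ∃ ε > (0:ℝ), ∃ y' : ℝ, (y' : EReal) < r ∧
      ∀ y ∈ D, y' < y → (y : EReal) < r → ε ≤ f y)
    -- the subgradients of `f` blow up at `r`
    (hblow : ∀ M : ℝ, 0 < M → ∃ y' : ℝ, (y' : EReal) < r ∧
      ∀ y ∈ D, y' < y → (y : EReal) < r →
        ∀ q : ℝ, (∀ z ∈ D, f y + q * (z - y) ≤ f z) → M ≤ q)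
    (k₁ k₂ : ℝ) (hk₁ : 0 ≤ k₁) (hk₂ : 0 ≤ k₂)
    -- `AE_r(f) < ∞`
    (hAE : ∃ C > (0:ℝ), ∃ y₀ : ℝ, (y₀ : EReal) < r ∧
      ∀ y ∈ D, y₀ < y → (y : EReal) < r →
        ∀ q : ℝ, (∀ z ∈ D, f y + q * (z - y) ≤ f z) → |q| * y ≤ C * f y) :
    -- `AE_r(f^k) < ∞`
    ∃ C' > (0:ℝ), ∃ y₁ : ℝ, (y₁ : EReal) < r ∧
      ∀ y ∈ D, y₁ < y → (y : EReal) < r →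
        ∀ q : ℝ, (∀ z ∈ D, f y + q * (z - y) ≤ f z) →
          |q - k₁| * y ≤ C' * (f y - k₁ * y + k₂) := by
  obtain ⟨C, hC, y₀, hy₀, hAE⟩ := hAE
  obtain ⟨y', hy', hblow⟩ := hblow (k₁ + 2 * C * k₁ + 1) (by positivity)
  refine ⟨2 * C, by positivity, max (max y₀ y') 0, ?_, fun y hyD hy hyr q hq => ?_⟩
  · rcases max_choice (max y₀ y') 0 with h | h
    · rw [h]
      rcases max_choice y₀ y' with h | h <;> rwa [h]
    · rw [h]
      exact_mod_cast hr
  · obtain ⟨hy, hy_pos⟩ := max_lt_iff.1 hy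
    obtain ⟨hyy₀, hyy'⟩ := max_lt_iff.1 hy
    have hel := hAE y hyD hyy₀ hyr q hq
    have hM := hblow y hyD hyy' hyr q hq
    have hCk₁ : 0 ≤ C * k₁ := by positivity
    have hCk₂ : 0 ≤ C * k₂ := by positivity
    have hk₁y : 0 ≤ k₁ * y := by positivity
    have hqy : 0 ≤ (q - 2 * C * k₁) * y := mul_nonneg (by linarith) hy_pos.le
    rw [abs_of_nonneg (by linarith)] at hel ⊢
    linarith
end

section
/- Let U : ℝ → ℝ be a nonconstant, nondecreasing, concave function finite on all of ℝ with U(0) > 0, and let Ũ(y) := sup_{x ∈ ℝ} (U(x) − x·y) be its Fenchel transform. Suppose r ∈ (0, +∞] is such that int[dom(Ũ)] = (0, r) and r ∉ dom(Ũ), where dom(Ũ) := {y : Ũ(y) < +∞}. If the asymptotic elasticity condition AE_r(Ũ) < ∞ holds, i.e., there exist a constant C > 0 and y₀ < r such that |q|·y ≤ C·Ũ(y) for all y ∈ (y₀, r) and all q ∈ ∂Ũ(y), then r = +∞. -/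
/-- The Fenchel transform `Ũ(y) = sup_{x ∈ ℝ} (U x - x * y)`, as a real number
(meaningful on the effective domain `UtilDom`). -/
noncomputable def fenchel (U : ℝ → ℝ) (y : ℝ) : ℝ := sSup (Set.range fun x => U x - x * y)

/-- `y` belongs to the effective domain of the Fenchel transform of `U`,
i.e. `Ũ(y) < +∞`. -/
def fenchelDom (U : ℝ → ℝ) (y : ℝ) : Prop := BddAbove (Set.range fun x => U x - x * y)

/-- The Fenchel transform is convex on its effective domain. -/
theorem convexOn_fenchel (U : ℝ → ℝ) : ConvexOn ℝ {y | fenchelDom U y} (fenchel U) := by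
  have key : ∀ ⦃y⦄, fenchelDom U y → ∀ ⦃z⦄, fenchelDom U z → ∀ ⦃a b : ℝ⦄, 0 ≤ a → 0 ≤ b →
      a + b = 1 → ∀ x, U x - x * (a * y + b * z) ≤ a * fenchel U y + b * fenchel U z := by
    intro y hy z hz a b ha hb hab x
    have hxy : U x - x * y ≤ fenchel U y := le_csSup hy ⟨x, rfl⟩
    have hxz : U x - x * z ≤ fenchel U z := le_csSup hz ⟨x, rfl⟩
    calc U x - x * (a * y + b * z) = (a + b) * U x - x * (a * y + b * z) := by rw [hab, one_mul]
      _ = a * (U x - x * y) + b * (U x - x * z) := by ring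
      _ ≤ _ := by gcongr
  constructor
  · intro y hy z hz a b ha hb hab
    exact ⟨_, by rintro _ ⟨x, rfl⟩; exact key hy hz ha hb hab x⟩
  · intro y hy z hz a b ha hb hab
    exact csSup_le (Set.range_nonempty _) (by rintro _ ⟨x, rfl⟩; exact key hy hz ha hb hab x)

/-- A convex function on `ℝ` has a subgradient at every interior point of its domain. -/
theorem ConvexOn.exists_subgradient_of_mem_interior {S : Set ℝ} {f : ℝ → ℝ} {y : ℝ}
    (hf : ConvexOn ℝ S f) (hy : y ∈ interior S) :
    ∃ q : ℝ, ∀ z ∈ S, f y + q * (z - y) ≤ f z := by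
  refine ⟨derivWithin f (Set.Ioi y) y, fun z hz => ?_⟩
  rcases lt_trichotomy z y with hzy | rfl | hyz
  · have h := (hf.slope_le_leftDeriv_of_mem_interior hz hy hzy).trans
      (hf.leftDeriv_le_rightDeriv_of_mem_interior hy)
    rw [slope_def_field, div_le_iff₀ (sub_pos.2 hzy)] at h
    linarith
  · simp
  · have h := hf.rightDeriv_le_slope_of_mem_interior hy hz hyz
    rw [slope_def_field, le_div_iff₀ (sub_pos.2 hyz)] at h
    linarith

/-- Lemma 2.2 — if `int[dom(Ũ)] = (0, r)`, `r ∉ dom(Ũ)` and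
`AE_r(Ũ) < ∞`, then `r = +∞`. -/
theorem lemma_2_2 (U : ℝ → ℝ) (hconc : ConcaveOn ℝ Set.univ U) (hmono : Monotone U)
    (hnc : ∃ x₁ x₂ : ℝ, U x₁ ≠ U x₂) (hU0 : 0 < U 0)
    (r : EReal) (hr : 0 < r)
    -- `int[dom(Ũ)] = (0, r)` and `r ∉ dom(Ũ)`
    (h1 : ∀ y : ℝ, 0 < y → (y : EReal) < r → fenchelDom U y)
    (h2 : ∀ y : ℝ, fenchelDom U y → 0 ≤ y ∧ (y : EReal) ≤ r)
    (h3 : ∀ y : ℝ, (y : EReal) = r → ¬ fenchelDom U y)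
    -- `AE_r(Ũ) < ∞`
    (hAE : ∃ C > (0:ℝ), ∃ y₀ : ℝ, (y₀ : EReal) < r ∧
      ∀ y : ℝ, y₀ < y → (y : EReal) < r → fenchelDom U y →
        ∀ q : ℝ, (∀ z : ℝ, fenchelDom U z → fenchel U y + q * (z - y) ≤ fenchel U z) →
          |q| * y ≤ C * fenchel U y) :
    r = ⊤ := by
  obtain ⟨C, hC, y₀, hy₀, hAE⟩ := hAE
  by_contra hrt
  lift r to ℝ using ⟨hrt, (EReal.bot_lt_zero.trans hr).ne'⟩
  norm_cast at hr hy₀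
  set y := max (max y₀ (r / 2)) (r - r / (4 * C)) with hy
  have hyy₀ : y₀ ≤ y := (le_max_left _ _).trans (le_max_left _ _)
  have hyr2 : r / 2 ≤ y := (le_max_right _ _).trans (le_max_left _ _)
  have hyC : r - r / (4 * C) ≤ y := le_max_right _ _
  have hrC : 0 < r / (4 * C) := by positivity
  have hyr : y < r := max_lt (max_lt hy₀ (by linarith)) (by linarith)
  have hCy : C * (r - y) ≤ r / 4 := by
    calc C * (r - y) ≤ C * (r / (4 * C)) := by gcongr; linarith
      _ = r / 4 := by field_simp
  have hdom : ∀ z : ℝ, 0 < z → z < r → fenchelDom U z := fun z hz hzr =>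
    h1 z hz (EReal.coe_lt_coe_iff.2 hzr)
  have hydom : fenchelDom U y := hdom y (by linarith) hyr
  have bound : ∀ z, y < z → z < r → fenchel U z ≤ 2 * fenchel U y := by
    intro z hyz hzr
    have hz0 : 0 < z := by linarith
    have hzdom := hdom z hz0 hzr
    have hzint : z ∈ interior {y | fenchelDom U y} :=
      interior_maximal (fun w hw => hdom w hw.1 hw.2) isOpen_Ioo ⟨hz0, hzr⟩
    obtain ⟨q, hq⟩ := (convexOn_fenchel U).exists_subgradient_of_mem_interior hzint
    have hqz := hAE z (by linarith) (EReal.coe_lt_coe_iff.2 hzr) hzdom q hq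
    have hqy := hq y hydom
    have hFz : 0 < fenchel U z := hU0.trans_le (le_csSup hzdom ⟨0, by simp⟩)
    have hCz : C * (z - y) ≤ z / 2 := by
      have : C * (z - y) ≤ C * (r - y) := by gcongr
      linarith
    have hF : fenchel U z ≤ fenchel U y + |q| * (z - y) := by
      have : q * (z - y) ≤ |q| * (z - y) :=
        mul_le_mul_of_nonneg_right (le_abs_self q) (by linarith)
      linarith
    have hq2 : (|q| * (z - y)) * z ≤ (fenchel U z / 2) * z := by
      calc (|q| * (z - y)) * z = (|q| * z) * (z - y) := by ring
        _ ≤ (C * fenchel U z) * (z - y) := by gcongr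
        _ = fenchel U z * (C * (z - y)) := by ring
        _ ≤ fenchel U z * (z / 2) := by gcongr
        _ = _ := by ring
    linarith [le_of_mul_le_mul_right hq2 hz0]
  refine h3 r rfl ⟨2 * fenchel U y, ?_⟩
  rintro _ ⟨x, rfl⟩
  have hcont : Filter.Tendsto (fun z => U x - x * z) (nhdsWithin r (Set.Iio r))
      (nhds (U x - x * r)) :=
    (Continuous.tendsto (by fun_prop) r).mono_left nhdsWithin_le_nhds
  refine le_of_tendsto hcont ?_
  filter_upwards [Ioo_mem_nhdsLT hyr] with z hz
  exact (le_csSup (hdom z (by linarith [hz.1]) hz.2) ⟨x, rfl⟩).trans (bound z hz.1 hz.2)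
end

section
/- Let f : (0, ∞) → (0, ∞) be a finite, positive, convex function which is nonincreasing on (0, a] for some a > 0 and nondecreasing on [b, ∞) for some b ≥ a. Assume the asymptotic elasticity conditions AE_0(f) < ∞ and AE_∞(f) < ∞ hold. Then there exists a constant C > 0 such that y·|q| ≤ C·f(y) for all y > 0 and all q ∈ ∂f(y). -/
/-- A subgradient at `y` of a nonnegative function on `(0, ∞)` is controlled by the values at `y / 2`
and `2 * y`. -/
lemma mul_abs_le_of_subgradient {f : ℝ → ℝ} (hf : ∀ y : ℝ, 0 < y → 0 ≤ f y) {y q : ℝ}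
    (hy : 0 < y) (hq : ∀ z : ℝ, 0 < z → f y + q * (z - y) ≤ f z) :
    y * |q| ≤ 2 * f (y / 2) + f (2 * y) := by
  have h_half := hq (y / 2) (by positivity)
  have h_double := hq (2 * y) (by positivity)
  have hfy := hf y hy
  have hf_half := hf (y / 2) (by positivity)
  have hf_double := hf (2 * y) (by positivity)
  rcases abs_cases q with ⟨h, _⟩ | ⟨h, _⟩ <;> rw [h] <;> linarith

/-- On a compact interval of `(0, ∞)`, the elasticity of a positive convex function is bounded. -/
lemma exists_elasticity_bound_on_Icc {f : ℝ → ℝ} (hconv : ConvexOn ℝ (Set.Ioi (0 : ℝ)) f)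
    (hpos : ∀ y : ℝ, 0 < y → 0 < f y) {r : ℝ} (hr : 0 < r) (R : ℝ) :
    ∃ C : ℝ, ∀ y ∈ Set.Icc r R,
      ∀ q : ℝ, (∀ z : ℝ, 0 < z → f y + q * (z - y) ≤ f z) → y * |q| ≤ C * f y := by
  have hcont : ContinuousOn f (Set.Ioi 0) := hconv.continuousOn isOpen_Ioi
  have hIcc : ∀ y ∈ Set.Icc r R, 0 < y := fun y hy => hr.trans_le hy.1
  have hquot : ContinuousOn (fun y => (2 * f (y / 2) + f (2 * y)) / f y) (Set.Icc r R) := by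
    refine ContinuousOn.div (ContinuousOn.add (continuousOn_const.mul ?_) ?_)
      (hcont.mono hIcc) fun y hy => (hpos y (hIcc y hy)).ne'
    · exact hcont.comp (by fun_prop) fun y hy => half_pos (hIcc y hy)
    · exact hcont.comp (by fun_prop) fun y hy => mul_pos two_pos (hIcc y hy)
  obtain ⟨C, hC⟩ := isCompact_Icc.bddAbove_image hquot
  refine ⟨C, fun y hy q hq => ?_⟩
  have hy0 := hIcc y hy
  exact (mul_abs_le_of_subgradient (fun z hz => (hpos z hz).le) hy0 hq).trans
    ((div_le_iff₀ (hpos y hy0)).1 (hC (Set.mem_image_of_mem _ hy)))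

/-- Lemma 2.3(ii) — for a positive convex function `f` on `(0, ∞)`,
nonincreasing near `0`, nondecreasing near `∞`, satisfying `AE_0(f) < ∞` and
`AE_∞(f) < ∞`: there is `C > 0` with `y |q| ≤ C f y` for all `y > 0` and all
`q ∈ ∂f(y)`. -/
theorem lemma_2_3_ii (f : ℝ → ℝ) (a b : ℝ) (ha : 0 < a) (hab : a ≤ b)
    (hconv : ConvexOn ℝ (Set.Ioi (0:ℝ)) f)
    (hpos : ∀ y : ℝ, 0 < y → 0 < f y)
    (hanti : AntitoneOn f (Set.Ioc 0 a))
    (hmono : MonotoneOn f (Set.Ici b))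
    -- `AE_0(f) < ∞`
    (hAE0 : ∃ C > (0:ℝ), ∃ δ > (0:ℝ), ∀ y : ℝ, 0 < y → y < δ →
      ∀ q : ℝ, (∀ z : ℝ, 0 < z → f y + q * (z - y) ≤ f z) → |q| * y ≤ C * f y)
    -- `AE_∞(f) < ∞`
    (hAEinf : ∃ C > (0:ℝ), ∃ y₀ > (0:ℝ), ∀ y : ℝ, y₀ ≤ y →
      ∀ q : ℝ, (∀ z : ℝ, 0 < z → f y + q * (z - y) ≤ f z) → |q| * y ≤ C * f y) :
    ∃ C > (0:ℝ), ∀ y : ℝ, 0 < y →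
      ∀ q : ℝ, (∀ z : ℝ, 0 < z → f y + q * (z - y) ≤ f z) → y * |q| ≤ C * f y := by
  obtain ⟨C₀, hC₀, δ, hδ, h₀⟩ := hAE0
  obtain ⟨C₁, hC₁, y₀, -, h₁⟩ := hAEinf
  obtain ⟨C₂, h₂⟩ := exists_elasticity_bound_on_Icc hconv hpos hδ y₀
  refine ⟨max C₀ (max C₁ C₂), lt_max_of_lt_left hC₀, fun y hy q hq => ?_⟩
  have hfy := (hpos y hy).le
  rcases lt_or_ge y δ with hyδ | hyδ
  · rw [mul_comm]
    exact (h₀ y hy hyδ q hq).trans (mul_le_mul_of_nonneg_right (le_max_left _ _) hfy)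
  rcases le_total y₀ y with hy₀ | hy₀
  · rw [mul_comm]
    exact (h₁ y hy₀ q hq).trans (mul_le_mul_of_nonneg_right
      ((le_max_left _ _).trans (le_max_right _ _)) hfy)
  · exact (h₂ y ⟨hyδ, hy₀⟩ q hq).trans (mul_le_mul_of_nonneg_right
      ((le_max_right _ _).trans (le_max_right _ _)) hfy)
end

section
/- Let f : (0, ∞) → (0, ∞) be a finite, positive, convex function which is nondecreasing on [b, ∞) for some b > 0. Then the asymptotic elasticity condition AE_∞(f) < ∞ holds (i.e., there exist C > 0 and y₀ > 0 such that |q|·y ≤ C·f(y) for all y ≥ y₀ and all q ∈ ∂f(y)) if and only if there exist constants β > 0 and y₁ > 0 such that f(μ·y) ≤ μ^β·f(y) for all μ ≥ 1 and all y ≥ y₁. -/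
/-- The right derivative of a convex function on an interval is a subgradient at interior points. -/
theorem ConvexOn.add_rightDeriv_mul_sub_le {S : Set ℝ} {f : ℝ → ℝ} (hf : ConvexOn ℝ S f)
    {x z : ℝ} (hx : x ∈ interior S) (hz : z ∈ S) :
    f x + derivWithin f (Set.Ioi x) x * (z - x) ≤ f z := by
  rcases lt_trichotomy x z with h | rfl | h
  · have h1 := hf.rightDeriv_le_slope_of_mem_interior hx hz h
    rw [slope_def_field, le_div_iff₀ (sub_pos.2 h)] at h1
    linarith
  · simp
  · have h1 := (hf.slope_le_leftDeriv_of_mem_interior hz hx h).trans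
      (hf.leftDeriv_le_rightDeriv_of_mem_interior hx)
    rw [slope_def_field, div_le_iff₀ (sub_pos.2 h)] at h1
    linarith

/-- If the right derivative of a positive continuous function is at most `C * f x / x`,
then the function grows at most like any power with exponent exceeding `C`. -/
theorem le_rpow_mul_of_rightDeriv_mul_le {f f' : ℝ → ℝ} {C β y w : ℝ} (hy : 0 < y)
    (hCβ : C < β) (hf : ContinuousOn f (Set.Icc y w))
    (hpos : ∀ x ∈ Set.Icc y w, 0 < f x)
    (hf' : ∀ x ∈ Set.Ico y w, HasDerivWithinAt f (f' x) (Set.Ici x) x)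
    (hle : ∀ x ∈ Set.Ico y w, f' x * x ≤ C * f x) (hyw : y ≤ w) :
    f w ≤ (w / y) ^ β * f y := by
  have hB : ∀ x ∈ Set.Icc y w, HasDerivAt (fun x => (x / y) ^ β * f y)
      (1 / y * β * (x / y) ^ (β - 1) * f y) x := fun x hx =>
    ((((hasDerivAt_id x).div_const y).rpow_const
      (Or.inl (div_pos (hy.trans_le hx.1) hy).ne')).mul_const (f y))
  refine image_le_of_deriv_right_lt_deriv_boundary' hf hf'
    (B := fun x => (x / y) ^ β * f y) (by simp [hy.ne'])
    (fun x hx => (hB x hx).continuousAt.continuousWithinAt)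
    (fun x hx => (hB x (Set.Ico_subset_Icc_self hx)).hasDerivWithinAt)
    (fun x hx hfx => ?_) (Set.right_mem_Icc.2 hyw)
  have hx0 : 0 < x := hy.trans_le hx.1
  refine lt_of_mul_lt_mul_right ((hle x hx).trans_lt ?_) hx0.le
  have h2 : 1 / y * β * (x / y) ^ (β - 1) * f y * x = β * f x := by
    rw [hfx, Real.rpow_sub_one (div_pos hx0 hy).ne']
    field_simp
  rw [h2]
  exact mul_lt_mul_of_pos_right hCβ (hpos x (Set.Ico_subset_Icc_self hx))


/-- characterization of `AE_∞(f) < ∞` (Step 2 of the proof of Lemma 2.3,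
analogue of Lemma 4.1 of Deelstra–Pham–Touzi): for a positive convex function `f` on
`(0, ∞)` which is nondecreasing on `[b, ∞)`, `AE_∞(f) < ∞` holds iff there are
`β > 0`, `y₁ > 0` with `f (μ y) ≤ μ^β f y` for all `μ ≥ 1` and `y ≥ y₁`. -/
theorem AE_infty_characterization (f : ℝ → ℝ) (b : ℝ) (hb : 0 < b)
    (hconv : ConvexOn ℝ (Set.Ioi (0:ℝ)) f)
    (hpos : ∀ y : ℝ, 0 < y → 0 < f y)
    (hmono : MonotoneOn f (Set.Ici b)) :
    (∃ C > (0:ℝ), ∃ y₀ > (0:ℝ), ∀ y : ℝ, y₀ ≤ y →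
      ∀ q : ℝ, (∀ z : ℝ, 0 < z → f y + q * (z - y) ≤ f z) → |q| * y ≤ C * f y)
    ↔ (∃ β > (0:ℝ), ∃ y₁ > (0:ℝ), ∀ μ : ℝ, 1 ≤ μ → ∀ y : ℝ, y₁ ≤ y →
      f (μ * y) ≤ μ ^ β * f y) := by
  constructor
  · rintro ⟨C, hC, y₀, hy₀, h⟩
    refine ⟨C + 1, by linarith, y₀, hy₀, fun μ hμ y hy => ?_⟩
    have hy0 : 0 < y := hy₀.trans_le hy
    have hint : ∀ x, y ≤ x → x ∈ interior (Set.Ioi (0:ℝ)) := fun x hx => by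
      rw [interior_Ioi]; exact hy0.trans_le hx
    have key := le_rpow_mul_of_rightDeriv_mul_le (f := f)
      (f' := fun x => derivWithin f (Set.Ioi x) x) (w := μ * y) hy0 (lt_add_one C)
      ((hconv.continuousOn isOpen_Ioi).mono fun x hx => hy0.trans_le hx.1)
      (fun x hx => hpos x (hy0.trans_le hx.1))
      (fun x hx => (hconv.hasDerivWithinAt_rightDeriv_of_mem_interior (hint x hx.1)).Ici_of_Ioi)
      (fun x hx => le_trans
        (mul_le_mul_of_nonneg_right (le_abs_self _) (hy0.trans_le hx.1).le)
        (h x (hy.trans hx.1) _ fun z hz => hconv.add_rightDeriv_mul_sub_le (hint x hx.1) hz))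
      (le_mul_of_one_le_left hy0.le hμ)
    rwa [mul_div_cancel_right₀ _ hy0.ne'] at key
  · rintro ⟨β, hβ, y₁, hy₁, h⟩
    refine ⟨2 ^ β, by positivity, max y₁ (b + 1), lt_max_of_lt_left hy₁, fun y hy q hq => ?_⟩
    have hby : b < y := by linarith [(le_max_right y₁ (b + 1)).trans hy]
    have hy0 : 0 < y := hb.trans hby
    have hq0 : 0 ≤ q := by
      have h1 := hq b hb
      have h2 := hmono Set.self_mem_Ici hby.le hby.le
      by_contra! hneg
      nlinarith [mul_pos_of_neg_of_neg hneg (sub_neg.2 hby)]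
    rw [abs_of_nonneg hq0]
    have h1 := hq (2 * y) (by linarith)
    have h2 := h 2 one_le_two y ((le_max_left _ _).trans hy)
    linarith [hpos y hy0]
end

section
/- Let a < b with b < ∞, let f be a convex function, finite and positive on [a, b), and suppose there exists a constant C > 0 such that q ≤ C·f(y) for every y ∈ [a, b) and every q in the subdifferential of f at y relative to [a, b). Then f(y) ≤ f(a)·e^{C·(y − a)} for all y ∈ [a, b); in particular, f is bounded on [a, b), i.e., lim_{y↑b} f(y) < ∞. -/
open Set Filter Topology

/-- At an interior point the right derivative of a convex function is a subgradient. -/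
theorem ConvexOn.add_rightDeriv_mul_le {S : Set ℝ} {f : ℝ → ℝ} (hf : ConvexOn ℝ S f) {x z : ℝ}
    (hx : x ∈ interior S) (hz : z ∈ S) :
    f x + derivWithin f (Ioi x) x * (z - x) ≤ f z := by
  rcases lt_trichotomy z x with h | rfl | h
  · have h1 := (hf.slope_le_leftDeriv_of_mem_interior hz hx h).trans
      (hf.leftDeriv_le_rightDeriv_of_mem_interior hx)
    rw [slope_def_field, div_le_iff₀ (sub_pos.2 h)] at h1
    linarith
  · simp
  · have h1 := hf.rightDeriv_le_slope_of_mem_interior hx hz h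
    rw [slope_def_field, le_div_iff₀ (sub_pos.2 h)] at h1
    linarith

/-- Grönwall's inequality for a convex function on an interval interior to its domain. -/
theorem ConvexOn.le_mul_exp_of_rightDeriv_le {S : Set ℝ} {f : ℝ → ℝ} (hf : ConvexOn ℝ S f)
    {C c y : ℝ} (hcy : c ≤ y) (hS : Icc c y ⊆ interior S)
    (hC : ∀ x ∈ Icc c y, derivWithin f (Ioi x) x ≤ C * f x) :
    f y ≤ f c * Real.exp (C * (y - c)) := by
  have h := le_gronwallBound_of_liminf_deriv_right_le (f := f)
    (f' := fun x ↦ derivWithin f (Ioi x) x) (δ := f c) (K := C) (ε := 0) (a := c) (b := y)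
    (hf.continuousOn_interior.mono hS) ?_ le_rfl
    (fun x hx ↦ by simpa using hC x (Ico_subset_Icc_self hx)) y (right_mem_Icc.2 hcy)
  · rwa [gronwallBound_ε0] at h
  · intro x hx r hr
    have hd := hf.hasDerivWithinAt_rightDeriv_of_mem_interior (hS (Ico_subset_Icc_self hx))
    rw [hasDerivWithinAt_iff_tendsto_slope' self_notMem_Ioi] at hd
    exact (hd.eventually_lt_const hr).frequently

/-- Gronwall-type bound used in Step 2 of the proof of Lemma 2.2 — if `f`
is convex, finite and positive on `[a, b)` and every subgradient `q` of `f` at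
`y ∈ [a, b)` (relative to `[a, b)`) satisfies `q ≤ C f y`, then
`f y ≤ f a * exp (C (y - a))` on `[a, b)`; in particular `f` is bounded on `[a, b)`. -/
theorem exp_bound_of_subgradient_bound (a b : ℝ) (hab : a < b) (f : ℝ → ℝ)
    (hconv : ConvexOn ℝ (Set.Ico a b) f)
    (hpos : ∀ y ∈ Set.Ico a b, 0 < f y)
    (C : ℝ) (hC : 0 < C)
    (hsub : ∀ y ∈ Set.Ico a b, ∀ q : ℝ,
      (∀ z ∈ Set.Ico a b, f y + q * (z - y) ≤ f z) → q ≤ C * f y) :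
    (∀ y ∈ Set.Ico a b, f y ≤ f a * Real.exp (C * (y - a))) ∧
    BddAbove (f '' Set.Ico a b) := by
  have hint : ∀ x ∈ Ioo a b, derivWithin f (Ioi x) x ≤ C * f x := fun x hx ↦
    hsub x (Ioo_subset_Ico_self hx) _ fun z hz ↦
      hconv.add_rightDeriv_mul_le (by rwa [interior_Ico]) hz
  have hle : ∀ y ∈ Ico a b, f y ≤ f a * Real.exp (C * (y - a)) := by
    intro y hy
    rcases hy.1.eq_or_lt with rfl | hay
    · simp
    have hlim : Tendsto
        (fun c ↦ (f a + (c - a) * ((f y - f a) / (y - a))) * Real.exp (C * (y - c)))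
        (𝓝[>] a) (𝓝 (f a * Real.exp (C * (y - a)))) := by
      have hcont : Continuous
          fun c ↦ (f a + (c - a) * ((f y - f a) / (y - a))) * Real.exp (C * (y - c)) := by
        fun_prop
      simpa using (hcont.tendsto a).mono_left nhdsWithin_le_nhds
    refine ge_of_tendsto hlim ?_
    filter_upwards [Ioo_mem_nhdsGT hay] with c hc
    have hsubset : Icc c y ⊆ Ioo a b := Icc_subset_Ioo hc.1 hy.2
    have hgron := hconv.le_mul_exp_of_rightDeriv_le hc.2.le
      (by rwa [interior_Ico]) fun x hx ↦ hint x (hsubset hx)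
    have hchord : f c ≤ f a + (c - a) * ((f y - f a) / (y - a)) := by
      have h := hconv.secant_mono (left_mem_Ico.2 hab) ⟨hc.1.le, hc.2.trans hy.2⟩ hy
        hc.1.ne' hay.ne' hc.2.le
      rw [div_le_iff₀ (sub_pos.2 hc.1)] at h
      linarith
    exact hgron.trans (by gcongr)
  refine ⟨hle, f a * Real.exp (C * (b - a)), ?_⟩
  rintro _ ⟨y, hy, rfl⟩
  have ha := hpos a (left_mem_Ico.2 hab)
  refine (hle y hy).trans ?_
  gcongr
  exact hy.2.le
end

section
/- Let U : ℝ → ℝ be a nonconstant, nondecreasing, concave function finite on all of ℝ, and suppose inf ⋃_{x ∈ ℝ} ∂U(x) = 0 and r := sup ⋃_{x ∈ ℝ} ∂U(x) ∉ ⋃_{x ∈ ℝ} ∂U(x), with r ∈ (0, +∞]. Let Ũ(y) := sup_{x ∈ ℝ} (U(x) − x·y) be the Fenchel transform of U. Then the minimal subgradients of Ũ tend to +∞ at r: for every M > 0 there exists y' < r such that for every y ∈ (y', r) with Ũ(y) finite and every q ∈ ∂Ũ(y), one has q ≥ M. In particular, Ũ is nondecreasing on (y'', r) ∩ {Ũ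 < +∞} for some y'' < r. -/
/-- The union `⋃_{x ∈ ℝ} ∂U(x)` of all superdifferentials of the concave function `U`. -/
def superGradients (U : ℝ → ℝ) : Set ℝ :=
  {p : ℝ | ∃ x : ℝ, ∀ z : ℝ, U z ≤ U x + p * (z - x)}

/-- A concave function on the real line has a supergradient at every point. -/
theorem ConcaveOn.exists_supergradient {U : ℝ → ℝ} (hU : ConcaveOn ℝ Set.univ U) (x : ℝ) :
    ∃ p : ℝ, ∀ z : ℝ, U z ≤ U x + p * (z - x) := by
  have hx : x ∈ interior (Set.univ : Set ℝ) := by simp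
  have hV : ConvexOn ℝ Set.univ (-U) := hU.neg
  refine ⟨-derivWithin (-U) (Set.Ioi x) x, fun z => ?_⟩
  rcases lt_trichotomy z x with hz | rfl | hz
  · have h := (hV.slope_le_leftDeriv_of_mem_interior (Set.mem_univ z) hx hz).trans
      (hV.leftDeriv_le_rightDeriv_of_mem_interior hx)
    rw [slope_def_field, div_le_iff₀ (sub_pos.2 hz)] at h
    simp only [Pi.neg_apply] at h
    linarith
  · simp
  · have h := hV.rightDeriv_le_slope_of_mem_interior hx (Set.mem_univ z) hz
    rw [slope_def_field, le_div_iff₀ (sub_pos.2 hz)] at h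
    simp only [Pi.neg_apply] at h
    linarith

/-- The Fenchel inequality. -/
theorem le_fenchel {U : ℝ → ℝ} {y : ℝ} (hy : fenchelDom U y) (x : ℝ) :
    U x - x * y ≤ fenchel U y :=
  le_csSup hy ⟨x, rfl⟩

theorem fenchelDom_of_supergradient {U : ℝ → ℝ} {x p : ℝ}
    (hp : ∀ z : ℝ, U z ≤ U x + p * (z - x)) : fenchelDom U p := by
  refine ⟨U x - x * p, ?_⟩
  rintro _ ⟨z, rfl⟩
  linarith [hp z]

theorem fenchel_le_of_supergradient {U : ℝ → ℝ} {x p : ℝ}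
    (hp : ∀ z : ℝ, U z ≤ U x + p * (z - x)) : fenchel U p ≤ U x - x * p := by
  refine csSup_le (Set.range_nonempty _) ?_
  rintro _ ⟨z, rfl⟩
  linarith [hp z]

/-- If `p` is a supergradient of `U` at `x`, then every subgradient of the Fenchel transform at a
point to the right of `p` is at least `-x`. -/
theorem neg_le_of_fenchel_subgradient {U : ℝ → ℝ} {x p y q : ℝ}
    (hp : ∀ z : ℝ, U z ≤ U x + p * (z - x)) (hpy : p < y) (hy : fenchelDom U y)
    (hq : ∀ z : ℝ, fenchelDom U z → fenchel U y + q * (z - y) ≤ fenchel U z) : -x ≤ q := by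
  have h₁ := hq p (fenchelDom_of_supergradient hp)
  have h₂ := fenchel_le_of_supergradient hp
  have h₃ := le_fenchel hy x
  refine le_of_mul_le_mul_right ?_ (sub_pos.2 hpy)
  linarith

/-- The Fenchel transform is nondecreasing to the right of any supergradient of `U` at `0`. -/
theorem fenchel_le_fenchel_of_supergradient_zero {U : ℝ → ℝ} {p y z : ℝ}
    (hp : ∀ w : ℝ, U w ≤ U 0 + p * (w - 0)) (hpy : p ≤ y) (hyz : y ≤ z) (hz : fenchelDom U z) :
    fenchel U y ≤ fenchel U z := by
  refine csSup_le (Set.range_nonempty _) ?_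
  rintro _ ⟨x, rfl⟩
  rcases le_total x 0 with hx | hx
  · have := mul_le_mul_of_nonpos_left hyz hx
    linarith [le_fenchel hz x]
  · have := mul_le_mul_of_nonneg_left hpy hx
    linarith [le_fenchel hz 0, hp x]

/-- Remark 2.1 — under condition (2.2) on `U`, the minimal subgradients of
`Ũ` tend to `+∞` at `r`; in particular `Ũ` is nondecreasing near `r`. -/
theorem remark_2_1 (U : ℝ → ℝ) (hconc : ConcaveOn ℝ Set.univ U) (hmono : Monotone U)
    (hnc : ∃ x₁ x₂ : ℝ, U x₁ ≠ U x₂)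
    (r : EReal) (hr : 0 < r)
    -- `inf ⋃ ∂U(x) = 0`
    (hinf₁ : ∀ p ∈ superGradients U, 0 ≤ p)
    (hinf₂ : ∀ ε : ℝ, 0 < ε → ∃ p ∈ superGradients U, p < ε)
    -- `r = sup ⋃ ∂U(x)` and `r ∉ ⋃ ∂U(x)`
    (hsup₁ : ∀ p ∈ superGradients U, (p : EReal) ≤ r)
    (hsup₂ : ∀ c : ℝ, (c : EReal) < r → ∃ p ∈ superGradients U, c < p)
    (hrnot : ∀ p ∈ superGradients U, (p : EReal) ≠ r) :
    -- minimal subgradients of `Ũ` tend to `+∞` at `r`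
    (∀ M : ℝ, 0 < M → ∃ y' : ℝ, (y' : EReal) < r ∧
      ∀ y : ℝ, y' < y → (y : EReal) < r → fenchelDom U y →
        ∀ q : ℝ, (∀ z : ℝ, fenchelDom U z → fenchel U y + q * (z - y) ≤ fenchel U z) →
          M ≤ q)
    -- in particular `Ũ` is nondecreasing near `r`
    ∧ (∃ y'' : ℝ, (y'' : EReal) < r ∧
      ∀ y z : ℝ, y'' < y → y ≤ z → (z : EReal) < r →
        fenchelDom U y → fenchelDom U z → fenchel U y ≤ fenchel U z) := by
  have exists_lt (x : ℝ) : ∃ p : ℝ, (p : EReal) < r ∧ ∀ z : ℝ, U z ≤ U x + p * (z - x) := by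
    obtain ⟨p, hp⟩ := hconc.exists_supergradient x
    exact ⟨p, lt_of_le_of_ne (hsup₁ p ⟨x, hp⟩) (hrnot p ⟨x, hp⟩), hp⟩
  constructor
  · intro M _
    obtain ⟨p, hpr, hp⟩ := exists_lt (-M)
    refine ⟨p, hpr, fun y hpy _ hy q hq => ?_⟩
    simpa using neg_le_of_fenchel_subgradient hp hpy hy hq
  · obtain ⟨p, hpr, hp⟩ := exists_lt 0
    exact ⟨p, hpr, fun y z hpy hyz _ _ hz =>
      fenchel_le_fenchel_of_supergradient_zero hp hpy.le hyz hz⟩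
end

section
/- Let β ≥ 0 and let U : ℝ → ℝ ∪ {−∞} be a nonconstant, nondecreasing, concave function with U(x) = −∞ for x < −2β, U finite on (−2β, ∞), and U(∞) := lim_{x→∞} U(x) > 0. Let Ũ(y) := sup_{x ∈ ℝ} (U(x) − x·y) be its Fenchel transform, assumed finite on all of (0, ∞). Then the function y ↦ Ũ(y) − 2β·y is nonincreasing on (0, ∞), and there exists δ > 0 such that Ũ(y) − 2β·y > 0 for all y ∈ (0, δ). -/
/-- The Fenchel transform `Ũ(y) = sup_{x > -2β} (U x - x * y)` of a utility function `U`
which equals `-∞` on `(-∞, -2β)` and is finite on `(-2β, ∞)` (real-valued; meaningful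
for `y > 0` where it is assumed finite). -/
noncomputable def fenchelB (β : ℝ) (U : ℝ → ℝ) (y : ℝ) : ℝ :=
  sSup ((fun x => U x - x * y) '' Set.Ioi (-(2*β)))

/-- The Fenchel inequality `U x - (x + 2β) y ≤ Ũ(y) - 2βy`. -/
theorem sub_mul_le_fenchelB_sub {β : ℝ} {U : ℝ → ℝ} {x y : ℝ}
    (hfin : BddAbove ((fun x => U x - x * y) '' Set.Ioi (-(2*β))))
    (hx : x ∈ Set.Ioi (-(2*β))) :
    U x - (x + 2*β) * y ≤ fenchelB β U y - 2*β*y := by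
  have h : U x - x * y ≤ fenchelB β U y := le_csSup hfin ⟨x, hx, rfl⟩
  linarith

/-- Remark 6.1(i) and (iii) — `y ↦ Ũ(y) - 2βy` is nonincreasing on `(0, ∞)`
and positive near `0`. -/
theorem remark_6_1 (β : ℝ) (hβ : 0 ≤ β) (U : ℝ → ℝ)
    (hconc : ConcaveOn ℝ (Set.Ioi (-(2*β))) U)
    (hmono : MonotoneOn U (Set.Ioi (-(2*β))))
    -- `U(∞) > 0`
    (hUpos : ∃ x ∈ Set.Ioi (-(2*β)), 0 < U x)
    -- `Ũ` is finite on `(0, ∞)`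
    (hfin : ∀ y : ℝ, 0 < y → BddAbove ((fun x => U x - x * y) '' Set.Ioi (-(2*β)))) :
    AntitoneOn (fun y => fenchelB β U y - 2*β*y) (Set.Ioi (0:ℝ)) ∧
    ∃ δ > (0:ℝ), ∀ y : ℝ, 0 < y → y < δ → 0 < fenchelB β U y - 2*β*y := by
  refine ⟨fun a ha b _ hab => ?_, ?_⟩
  · suffices h : fenchelB β U b ≤ fenchelB β U a - 2*β*a + 2*β*b from by
      simpa only [sub_le_iff_le_add] using h
    refine csSup_le (Set.nonempty_Ioi.image _) ?_
    rintro _ ⟨x, hx, rfl⟩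
    have h := sub_mul_le_fenchelB_sub (hfin a ha) hx
    have hx' : 0 ≤ x + 2*β := by linarith [Set.mem_Ioi.mp hx]
    have hm := mul_le_mul_of_nonneg_left hab hx'
    simp only
    linarith
  · obtain ⟨x, hx, hUx⟩ := hUpos
    have hx' : 0 < x + 2*β := by linarith [Set.mem_Ioi.mp hx]
    refine ⟨U x / (x + 2*β), div_pos hUx hx', fun y hy hyδ => ?_⟩
    have h := sub_mul_le_fenchelB_sub (hfin y hy) hx
    have hm := (lt_div_iff₀' hx').mp hyδ
    linarith
end

section
/- Let β ≥ 0 and let U : ℝ → ℝ ∪ {−∞} be a nonconstant, nondecreasing, concave function with U(x) = −∞ for x < −2β, U finite on (−2β, ∞), and U(∞) := lim_{x→∞} U(x) > 0. Let Ũ(y) := sup_{x ∈ ℝ} (U(x) − x·y) be its Fenchel transform, assumed finite on all of (0, ∞), and assume the asymptotic elasticity condition AE_0(Ũ) < ∞. Then for every ȳ ∈ (0, ∞) there exist constants γ > 0 and C ≥ 0 such that Ũ(μ·y) − 2β·μ·y ≤ μ^{−γ}·(Ũ(y) − 2β·y + C) for all μ ∈ [1/2, 1] and all y ∈ (0, ȳ).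 -/
/-- A convex function on an open set of reals has a subgradient at each point. -/
lemma ConvexOn.exists_subgradient_of_isOpen {S : Set ℝ} {f : ℝ → ℝ} (hf : ConvexOn ℝ S f)
    (hS : IsOpen S) {x : ℝ} (hx : x ∈ S) :
    ∃ q : ℝ, ∀ z ∈ S, f x + q * (z - x) ≤ f z := by
  have hxi : x ∈ interior S := by rwa [hS.interior_eq]
  refine ⟨derivWithin f (Set.Ioi x) x, fun z hz => ?_⟩
  rcases lt_trichotomy z x with h | rfl | h
  · have h₁ := (hf.slope_le_leftDeriv_of_mem_interior hz hxi h).trans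
      (hf.leftDeriv_le_rightDeriv_of_mem_interior hxi)
    rw [slope_def_field, div_le_iff₀ (sub_pos.2 h)] at h₁
    linarith
  · simp
  · have h₁ := hf.rightDeriv_le_slope_of_mem_interior hxi hz h
    rw [slope_def_field, le_div_iff₀ (sub_pos.2 h)] at h₁
    linarith

lemma le_fenchelB {β : ℝ} {U : ℝ → ℝ} {y : ℝ}
    (hfin : BddAbove ((fun x => U x - x * y) '' Set.Ioi (-(2*β)))) {x : ℝ}
    (hx : x ∈ Set.Ioi (-(2*β))) : U x - x * y ≤ fenchelB β U y :=
  le_csSup hfin ⟨x, hx, rfl⟩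

lemma fenchelB_le {β : ℝ} {U : ℝ → ℝ} {y a : ℝ}
    (h : ∀ x ∈ Set.Ioi (-(2*β)), U x - x * y ≤ a) : fenchelB β U y ≤ a := by
  refine csSup_le (Set.nonempty_Ioi.image _) ?_
  rintro _ ⟨x, hx, rfl⟩
  exact h x hx

lemma convexOn_fenchelB {β : ℝ} {U : ℝ → ℝ}
    (hfin : ∀ y : ℝ, 0 < y → BddAbove ((fun x => U x - x * y) '' Set.Ioi (-(2*β)))) :
    ConvexOn ℝ (Set.Ioi 0) (fenchelB β U) := by
  refine ⟨convex_Ioi 0, fun y hy z hz a b ha hb hab => fenchelB_le fun x hx => ?_⟩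
  have h₁ := mul_le_mul_of_nonneg_left (le_fenchelB (hfin y hy) hx) ha
  have h₂ := mul_le_mul_of_nonneg_left (le_fenchelB (hfin z hz) hx) hb
  obtain rfl : a = 1 - b := by linarith
  simp only [smul_eq_mul]
  linarith

/-- `y ↦ Ũ(y) - 2βy` is nonincreasing on `(0, ∞)`. -/
lemma antitoneOn_fenchelB_sub {β : ℝ} {U : ℝ → ℝ}
    (hfin : ∀ y : ℝ, 0 < y → BddAbove ((fun x => U x - x * y) '' Set.Ioi (-(2*β)))) :
    AntitoneOn (fun y => fenchelB β U y - 2*β*y) (Set.Ioi 0) := by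
  intro y hy z hz hyz
  suffices h : fenchelB β U z ≤ fenchelB β U y - 2*β*y + 2*β*z by
    simp only
    linarith
  refine fenchelB_le fun x hx => ?_
  have h₁ := le_fenchelB (hfin y hy) hx
  have h₂ : 0 ≤ (x + 2*β) * (z - y) :=
    mul_nonneg (by linarith [Set.mem_Ioi.1 hx]) (sub_nonneg.2 hyz)
  linarith

lemma one_le_exp_mul_one_sub {γ s : ℝ} (hγ : 0 < γ) (hs : 0 ≤ s) (hs₁ : s ≤ 1/2)
    (hs₂ : 4 * γ * s ≤ 1) : 1 ≤ Real.exp (4 * γ * s) * (1 - γ * (Real.exp s - 1)) := by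
  have h₁ : Real.exp s * (1 - s) ≤ 1 := by
    have h := mul_le_mul_of_nonneg_left (Real.one_sub_le_exp_neg s) (Real.exp_pos s).le
    rwa [← Real.exp_add, add_neg_cancel, Real.exp_zero] at h
  have h₂ : Real.exp s ≤ 2 := by nlinarith [Real.exp_pos s]
  have h₃ : Real.exp s - 1 ≤ 2 * s := by nlinarith
  have h₄ : 1 - 2 * γ * s ≤ 1 - γ * (Real.exp s - 1) := by nlinarith
  have h₅ : 0 ≤ γ * s := by positivity
  calc (1 : ℝ) ≤ (4 * γ * s + 1) * (1 - 2 * γ * s) := by nlinarith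
    _ ≤ Real.exp (4 * γ * s) * (1 - γ * (Real.exp s - 1)) :=
      mul_le_mul (Real.add_one_le_exp _) h₄ (by linarith) (Real.exp_pos _).le

/-- A Grönwall-type power growth bound from a bound on the elasticity of subgradients. -/
lemma le_exp_mul_of_subgradient_elasticity {W : ℝ → ℝ} {b γ : ℝ} (hγ : 0 < γ)
    (hW : ∀ y, 0 < y → y < b → 0 ≤ W y)
    (hq : ∀ y, 0 < y → y < b →
      ∃ q, -q * y ≤ γ * W y ∧ ∀ z, 0 < z → z < b → W y + q * (z - y) ≤ W z)
    {s : ℝ} (hs : 0 ≤ s) {y : ℝ} (hy : 0 < y) (hyb : y < b) :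
    W (Real.exp (-s) * y) ≤ Real.exp (4 * γ * s) * W y := by
  have small : ∀ t : ℝ, 0 ≤ t → t ≤ 1/2 → 4 * γ * t ≤ 1 → ∀ x, 0 < x → x < b →
      W (Real.exp (-t) * x) ≤ Real.exp (4 * γ * t) * W x := by
    intro t ht ht₁ ht₂ x hx hxb
    set v := Real.exp (-t) * x with hv
    have hv₀ : 0 < v := by positivity
    have hxv : x = Real.exp t * v := by
      rw [hv, ← mul_assoc, ← Real.exp_add, add_neg_cancel, Real.exp_zero, one_mul]
    have he : 1 ≤ Real.exp t := Real.one_le_exp ht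
    have hvb : v < b := by nlinarith
    obtain ⟨q, hq₁, hq₂⟩ := hq v hv₀ hvb
    have h₁ := hq₂ x hx hxb
    have h₂ : W v * (1 - γ * (Real.exp t - 1)) ≤ W x := by
      have h := mul_le_mul_of_nonneg_right hq₁ (sub_nonneg.2 he)
      have h' : q * (x - v) = - (-q * v * (Real.exp t - 1)) := by rw [hxv]; ring
      linarith
    have h₃ := mul_le_mul_of_nonneg_left h₂ (Real.exp_pos (4 * γ * t)).le
    have h₄ := mul_le_mul_of_nonneg_left (one_le_exp_mul_one_sub hγ ht ht₁ ht₂) (hW v hv₀ hvb)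
    linarith
  obtain ⟨n, hn⟩ := exists_nat_gt (2 * s + 4 * γ * s)
  have hn₀ : (0 : ℝ) < n := lt_of_le_of_lt (by positivity) hn
  have hγs : 0 ≤ 4 * γ * s := by positivity
  have ht₀ : 0 ≤ s / n := by positivity
  have ht₁ : s / n ≤ 1/2 := by rw [div_le_iff₀ hn₀]; linarith
  have ht₂ : 4 * γ * (s / n) ≤ 1 := by rw [← mul_div_assoc, div_le_iff₀ hn₀]; linarith
  have key : ∀ k : ℕ,
      W (Real.exp (-(k * (s / n))) * y) ≤ Real.exp (4 * γ * (k * (s / n))) * W y := by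
    intro k
    induction k with
    | zero => simp
    | succ k ih =>
      have hle : Real.exp (-(k * (s / n))) ≤ 1 := Real.exp_le_one_iff.2 (by
        have : 0 ≤ (k : ℝ) * (s / n) := by positivity
        linarith)
      have h := small (s / n) ht₀ ht₁ ht₂ (Real.exp (-(k * (s / n))) * y) (by positivity)
        (by nlinarith)
      have h' := mul_le_mul_of_nonneg_left ih (Real.exp_pos (4 * γ * (s / n))).le
      rw [← mul_assoc, ← Real.exp_add] at h h'
      have e₁ : -(((k + 1 : ℕ) : ℝ) * (s / n)) = -(s / n) + -(k * (s / n)) := by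
        push_cast; ring
      have e₂ : 4 * γ * (((k + 1 : ℕ) : ℝ) * (s / n))
          = 4 * γ * (s / n) + 4 * γ * (k * (s / n)) := by
        push_cast; ring
      rw [e₁, e₂]
      exact h.trans h'
  have h := key n
  rwa [mul_div_cancel₀ s hn₀.ne'] at h

/-- Remark 6.1(iv) — under `AE_0(Ũ) < ∞`, for every `ȳ > 0` there are
`γ > 0` and `C ≥ 0` with `Ũ(μy) - 2βμy ≤ μ^{-γ} (Ũ(y) - 2βy + C)` for all
`μ ∈ [1/2, 1]` and `y ∈ (0, ȳ)`. -/
theorem remark_6_1_iv (β : ℝ) (hβ : 0 ≤ β) (U : ℝ → ℝ)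
    (hconc : ConcaveOn ℝ (Set.Ioi (-(2*β))) U)
    (hmono : MonotoneOn U (Set.Ioi (-(2*β))))
    -- `U(∞) > 0`
    (hUpos : ∃ x ∈ Set.Ioi (-(2*β)), 0 < U x)
    -- `Ũ` is finite on `(0, ∞)`
    (hfin : ∀ y : ℝ, 0 < y → BddAbove ((fun x => U x - x * y) '' Set.Ioi (-(2*β))))
    -- `AE_0(Ũ) < ∞`
    (hAE : ∃ C > (0:ℝ), ∃ δ > (0:ℝ), ∀ y : ℝ, 0 < y → y < δ →
      ∀ q : ℝ, (∀ z : ℝ, 0 < z → fenchelB β U y + q * (z - y) ≤ fenchelB β U z) →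
        |q| * y ≤ C * fenchelB β U y) :
    ∀ ybar : ℝ, 0 < ybar → ∃ γ > (0:ℝ), ∃ C : ℝ, 0 ≤ C ∧
      ∀ μ ∈ Set.Icc (1/2 : ℝ) 1, ∀ y : ℝ, 0 < y → y < ybar →
        fenchelB β U (μ * y) - 2*β*(μ * y) ≤ μ ^ (-γ) * (fenchelB β U y - 2*β*y + C) := by
  intro b hb
  obtain ⟨K, hK, δ, hδ, hAE⟩ := hAE
  set V : ℝ → ℝ := fun y => fenchelB β U y - 2*β*y with hV
  have hanti : ∀ y z, 0 < y → y ≤ z → V z ≤ V y := fun y z hy hyz =>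
    antitoneOn_fenchelB_sub hfin hy (hy.trans_le hyz) hyz
  set D := |V (δ/2)| + |V b| with hD
  have hD₀ : 0 ≤ D := by positivity
  set C := (K + 1) * (2*β*b) / K + 2 * D / K + D with hC
  have hKC : K * C = (K + 1) * (2*β*b) + 2 * D + K * D := by
    rw [hC]; field_simp
  have hβb : 0 ≤ 2*β*b := by positivity
  have hDC : D ≤ C := by
    have : 0 ≤ (K + 1) * (2*β*b) / K + 2 * D / K := by positivity
    linarith
  have hDb : -D ≤ V b := by linarith [neg_abs_le (V b), abs_nonneg (V (δ/2))]
  have hdiff : V (δ/2) - V b ≤ D := by linarith [neg_abs_le (V b), le_abs_self (V (δ/2))]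
  have hlow : ∀ y, 0 < y → y < b → -D ≤ V y := fun y hy hyb =>
    hDb.trans (hanti y b hy hyb.le)
  refine ⟨4 * K, by positivity, C, hD₀.trans hDC, ?_⟩
  intro μ hμ y hy hyb
  have hμ₀ : 0 < μ := by linarith [hμ.1]
  have main := le_exp_mul_of_subgradient_elasticity (W := fun y => V y + C) (b := b) hK
    (fun y hy hyb => by linarith [hlow y hy hyb]) ?_
    (s := -Real.log μ) (by linarith [Real.log_nonpos hμ₀.le hμ.2]) hy hyb
  · rw [neg_neg, Real.exp_log hμ₀] at main
    have hexp : μ ^ (-(4 * K)) = Real.exp (4 * K * -Real.log μ) := by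
      rw [Real.rpow_def_of_pos hμ₀]; congr 1; ring
    rw [hexp]
    simp only [hV] at main
    linarith [hD₀.trans hDC]
  · intro y hy hyb
    obtain ⟨q, hq⟩ := (convexOn_fenchelB hfin).exists_subgradient_of_isOpen isOpen_Ioi hy
    have hqV : ∀ z, 0 < z → V y + (q - 2*β) * (z - y) ≤ V z := fun z hz => by
      have := hq z hz
      simp only [hV]
      linarith
    refine ⟨q - 2*β, ?_, fun z hz _ => by linarith [hqV z hz]⟩
    have hVy := hlow y hy hyb
    have hKV : 0 ≤ K * (V y + D) := mul_nonneg hK.le (by linarith)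
    rw [mul_add, hKC]
    rcases lt_or_ge y δ with hyδ | hyδ
    · have h₁ := hAE y hy hyδ q hq
      have h₂ : -q * y ≤ |q| * y := mul_le_mul_of_nonneg_right (neg_le_abs q) hy.le
      have h₃ : fenchelB β U y = V y + 2*β*y := by simp [hV]
      have h₄ : (K + 1) * (2*β*y) ≤ (K + 1) * (2*β*b) := by gcongr
      have h₅ : 0 ≤ K * D := by positivity
      rw [h₃] at h₁
      linarith
    · have h₁ := hqV (δ/2) (by linarith)
      have h₂ := hanti y b hy hyb.le
      have h₃ : -(q - 2*β) * (y - δ/2) ≤ D := by linarith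
      have h₄ : 0 ≤ (K + 1) * (2*β*b) := by positivity
      have h₅ : -(q - 2*β) * y ≤ 2 * D := by
        rcases le_or_gt 0 (-(q - 2*β)) with h | h <;> nlinarith
      linarith
end

section
/- Let β ≥ 0 and let U : ℝ → ℝ ∪ {−∞} be a nonconstant, nondecreasing, concave function with U(x) = −∞ for x < −2β, U finite on (−2β, ∞), and U(∞) := lim_{x→∞} U(x) > 0. Let Ũ(y) := sup_{x ∈ ℝ} (U(x) − x·y) be its Fenchel transform, assumed finite on all of (0, ∞), and set g(z) := Ũ(z) − β·z for z ≥ 0 (with Ũ(0) := sup_{x∈ℝ} U(x)). Fix y₀ > 0 and set z₀ := 2·y₀ + |β − q₀|, where q₀ := max ∂g(y₀) is the largest subgradient of g at y₀. Then for every integer n ≥ 1 and every y ∈ (0, y₀], the function z ↦ g(z) + (n/2)·(y − z)² is increasing on [z₀, ∞); consequently, inf_{z ≥ 0} (g(z) + (n/2)·(y − z)²) = inf_{0 ≤ z ≤ z₀} (g(z) + (n/2)·(y − z)²). -/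
/-- The Fenchel transform `Ũ(z) = sup_{x > -2β} (U x - x * z)` of a utility function `U`
which equals `-∞` on `(-∞, -2β)` and is finite on `(-2β, ∞)`, with values in the
extended reals (so that `Ũ(0) = sup_x U x`, possibly `+∞`). -/
noncomputable def fenchelBE (β : ℝ) (U : ℝ → ℝ) (z : ℝ) : EReal :=
  ⨆ x ∈ Set.Ioi (-(2*β)), ((U x - x * z : ℝ) : EReal)

/-- `g(z) := Ũ(z) - βz`, with values in the extended reals. -/
noncomputable def gB (β : ℝ) (U : ℝ → ℝ) (z : ℝ) : EReal :=
  fenchelBE β U z + ((-(β * z) : ℝ) : EReal)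

/-- Where the supremum defining the Fenchel transform is bounded, the transform is real. -/
theorem coe_toReal_fenchelBE {β : ℝ} {U : ℝ → ℝ} {z : ℝ}
    (h : BddAbove ((fun x => U x - x * z) '' Set.Ioi (-(2*β)))) :
    ((fenchelBE β U z).toReal : EReal) = fenchelBE β U z := by
  obtain ⟨C, hC⟩ := h
  refine EReal.coe_toReal (ne_top_of_le_ne_top (EReal.coe_ne_top C) ?_)
    (ne_bot_of_le_ne_bot
      (EReal.coe_ne_bot (U (-(2*β) + 1) - (-(2*β) + 1) * z)) ?_)
  · exact iSup₂_le fun x hx => EReal.coe_le_coe_iff.2 (hC ⟨x, hx, rfl⟩)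
  · exact le_iSup₂ (f := fun x (_ : x ∈ Set.Ioi (-(2*β))) => ((U x - x * z : ℝ) : EReal))
      (-(2*β) + 1) (by simp)

theorem convexOn_toReal_fenchelBE {β : ℝ} {U : ℝ → ℝ}
    (h : ∀ y : ℝ, 0 < y → BddAbove ((fun x => U x - x * y) '' Set.Ioi (-(2*β)))) :
    ConvexOn ℝ (Set.Ioi 0) fun z => (fenchelBE β U z).toReal := by
  have le_transform : ∀ z : ℝ, 0 < z → ∀ x ∈ Set.Ioi (-(2*β)),
      U x - x * z ≤ (fenchelBE β U z).toReal := fun z hz x hx => by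
    rw [← EReal.coe_le_coe_iff, coe_toReal_fenchelBE (h z hz)]
    exact le_iSup₂ (f := fun x (_ : x ∈ Set.Ioi (-(2*β))) => ((U x - x * z : ℝ) : EReal)) x hx
  refine ⟨convex_Ioi 0, fun u hu v hv a b ha hb hab => ?_⟩
  have hw := convex_Ioi (0 : ℝ) hu hv ha hb hab
  simp only [smul_eq_mul] at hw ⊢
  rw [← EReal.coe_le_coe_iff, coe_toReal_fenchelBE (h _ hw)]
  refine iSup₂_le fun x hx => EReal.coe_le_coe_iff.2 ?_
  have h1 := mul_le_mul_of_nonneg_left (le_transform u hu x hx) ha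
  have h2 := mul_le_mul_of_nonneg_left (le_transform v hv x hx) hb
  have h3 : U x = a * U x + b * U x := by rw [← add_mul, hab, one_mul]
  linarith

/-- A subgradient of a convex function at `y` bounds from below its slopes to the right of `y`. -/
theorem ConvexOn.mul_sub_le_sub_of_subgradient {s : Set ℝ} {f : ℝ → ℝ} (hf : ConvexOn ℝ s f)
    {y u v q : ℝ} (hy : y ∈ s) (hv : v ∈ s) (hyu : y < u) (huv : u < v)
    (hq : f y + q * (u - y) ≤ f u) : q * (v - u) ≤ f v - f u := by
  have h1 := hf.slope_mono_adjacent hy hv hyu huv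
  have h2 : q ≤ (f u - f y) / (u - y) := by
    rw [le_div_iff₀ (sub_pos.2 hyu)]; linarith
  exact (le_div_iff₀ (sub_pos.2 huv)).1 (h2.trans h1)

/-- Step 1 of the proof of Property 6.4 — with `g(z) = Ũ(z) - βz`,
`q₀ = max ∂g(y₀)` and `z₀ = 2y₀ + |β - q₀|`, for every `n ≥ 1` and `y ∈ (0, y₀]`
the map `z ↦ g(z) + (n/2)(y - z)²` is increasing on `[z₀, ∞)`; consequently its
infimum over `z ≥ 0` equals its infimum over `0 ≤ z ≤ z₀`. -/
theorem property_6_4_step1 (β : ℝ) (hβ : 0 ≤ β) (U : ℝ → ℝ)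
    (hconc : ConcaveOn ℝ (Set.Ioi (-(2*β))) U)
    (hmono : MonotoneOn U (Set.Ioi (-(2*β))))
    -- `U(∞) > 0`
    (hUpos : ∃ x ∈ Set.Ioi (-(2*β)), 0 < U x)
    -- `Ũ` is finite on `(0, ∞)`
    (hfin : ∀ y : ℝ, 0 < y → BddAbove ((fun x => U x - x * y) '' Set.Ioi (-(2*β))))
    (y₀ : ℝ) (hy₀ : 0 < y₀) (q₀ : ℝ)
    -- `q₀` is a subgradient of `g` at `y₀` (relative to `[0, ∞)`) ...
    (hq₀ : ∀ z : ℝ, 0 ≤ z →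
      (((gB β U y₀).toReal + q₀ * (z - y₀) : ℝ) : EReal) ≤ gB β U z)
    -- ... and it is the largest one
    (hq₀max : ∀ q : ℝ, (∀ z : ℝ, 0 ≤ z →
      (((gB β U y₀).toReal + q * (z - y₀) : ℝ) : EReal) ≤ gB β U z) → q ≤ q₀) :
    ∀ n : ℕ, 1 ≤ n → ∀ y : ℝ, 0 < y → y ≤ y₀ →
      StrictMonoOn (fun z => gB β U z + (((n:ℝ)/2 * (y - z)^2 : ℝ) : EReal))
        (Set.Ici (2*y₀ + |β - q₀|)) ∧
      (⨅ z ∈ Set.Ici (0:ℝ), (gB β U z + (((n:ℝ)/2 * (y - z)^2 : ℝ) : EReal)))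
        = ⨅ z ∈ Set.Icc (0:ℝ) (2*y₀ + |β - q₀|),
            (gB β U z + (((n:ℝ)/2 * (y - z)^2 : ℝ) : EReal)) := by
  have gB_eq : ∀ z : ℝ, 0 < z →
      gB β U z = (((fenchelBE β U z).toReal - β * z : ℝ) : EReal) := fun z hz => by
    rw [gB, ← coe_toReal_fenchelBE (hfin z hz), ← EReal.coe_add, EReal.toReal_coe, sub_eq_add_neg]
  have hconv : ConvexOn ℝ (Set.Ioi 0) fun z => (fenchelBE β U z).toReal - β * z := by
    refine (convexOn_toReal_fenchelBE hfin).sub ⟨convex_Ioi 0, fun u _ v _ a b _ _ _ => ?_⟩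
    simp only [smul_eq_mul]
    linarith
  intro n hn y hy hyy₀
  have hz₀ : 2 * y₀ ≤ 2 * y₀ + |β - q₀| := by linarith [abs_nonneg (β - q₀)]
  have hstrict : StrictMonoOn (fun z => gB β U z + (((n:ℝ)/2 * (y - z)^2 : ℝ) : EReal))
      (Set.Ici (2*y₀ + |β - q₀|)) := by
    intro u hu v hv huv
    rw [Set.mem_Ici] at hu hv
    have hu0 : 0 < u := by linarith
    have hv0 : 0 < v := by linarith
    have hsub := hq₀ u hu0.le
    rw [gB_eq y₀ hy₀, gB_eq u hu0, EReal.toReal_coe, EReal.coe_le_coe_iff] at hsub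
    have hslope := hconv.mul_sub_le_sub_of_subgradient (Set.mem_Ioi.2 hy₀) (Set.mem_Ioi.2 hv0)
      (by linarith) huv hsub
    simp only [gB_eq u hu0, gB_eq v hv0, ← EReal.coe_add, EReal.coe_lt_coe_iff]
    have hn1 : (1:ℝ) ≤ n := by exact_mod_cast hn
    have hquad : 1 * ((v - u) * (u + v - 2 * y)) ≤ n * ((v - u) * (u + v - 2 * y)) :=
      mul_le_mul_of_nonneg_right hn1 (mul_nonneg (by linarith) (by linarith))
    have hpos : 0 < (v - u) * (2 * q₀ + (u + v - 2 * y)) :=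
      mul_pos (by linarith) (by linarith [le_abs_self (β - q₀)])
    linarith
  refine ⟨hstrict, le_antisymm (biInf_mono fun z hz => hz.1) (le_iInf₂ fun z hz => ?_)⟩
  rcases le_total z (2*y₀ + |β - q₀|) with hle | hle
  · exact iInf₂_le (f := fun z (_ : z ∈ Set.Icc (0:ℝ) (2*y₀ + |β - q₀|)) =>
      gB β U z + (((n:ℝ)/2 * (y - z)^2 : ℝ) : EReal)) z ⟨hz, hle⟩
  · exact (iInf₂_le (f := fun z (_ : z ∈ Set.Icc (0:ℝ) (2*y₀ + |β - q₀|)) =>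
      gB β U z + (((n:ℝ)/2 * (y - z)^2 : ℝ) : EReal)) _ ⟨by linarith, le_rfl⟩).trans
      (hstrict.monotoneOn Set.self_mem_Ici hle hle)
end

section
/- Let β ≥ 0 and let U : ℝ → ℝ ∪ {−∞} be a nonconstant, nondecreasing, concave function with U(x) = −∞ for x < −2β, U finite on (−2β, ∞), and U(∞) := lim_{x→∞} U(x) > 0. Let Ũ(y) := sup_{x ∈ ℝ} (U(x) − x·y) be its Fenchel transform, assumed finite on all of (0, ∞). For each integer n ≥ 1 define the quadratic inf-convolution Ũ_n(y) := β·y + inf_{z ≥ 0} (Ũ(z) − β·z + (n/2)·(y − z)²) for y ∈ ℝ (with Ũ(0) := sup_{x∈ℝ} U(x)). Then for every n ≥ 1 the function y ↦ Ũ_n(y) − 2β·y is nonincreasing on ℝ. -/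
/-- The quadratic inf-convolution
`Ũ_n(y) := βy + inf_{z ≥ 0} (Ũ(z) - βz + (n/2)(y - z)²)`
(the infimum is taken in the extended reals and is in fact finite). -/
noncomputable def infConvB (β : ℝ) (U : ℝ → ℝ) (n : ℕ) (y : ℝ) : ℝ :=
  β * y + (⨅ z ∈ Set.Ici (0:ℝ),
    (fenchelBE β U z + (((n:ℝ)/2 * (y - z)^2 - β * z : ℝ) : EReal))).toReal

lemma coe_le_fenchelBE {β : ℝ} (U : ℝ → ℝ) {x : ℝ} (hx : x ∈ Set.Ioi (-(2*β))) (z : ℝ) :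
    ((U x - x * z : ℝ) : EReal) ≤ fenchelBE β U z :=
  le_iSup₂ (f := fun x (_ : x ∈ Set.Ioi (-(2*β))) => ((U x - x * z : ℝ) : EReal)) x hx

/-- The Fenchel transform grows at most at rate `2β`. -/
lemma fenchelBE_add_le (β : ℝ) (U : ℝ → ℝ) (z : ℝ) {d : ℝ} (hd : 0 ≤ d) :
    fenchelBE β U (z + d) ≤ fenchelBE β U z + ((2 * β * d : ℝ) : EReal) := by
  refine iSup₂_le fun x hx => ?_
  refine le_trans ?_ (add_le_add_left (coe_le_fenchelBE U hx z) _)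
  rw [← EReal.coe_add, EReal.coe_le_coe_iff]
  have : -(2 * β) < x := hx
  nlinarith

lemma fenchelBE_ne_bot (β : ℝ) (U : ℝ → ℝ) (z : ℝ) : fenchelBE β U z ≠ ⊥ :=
  ne_bot_of_le_ne_bot (EReal.coe_ne_bot _)
    (coe_le_fenchelBE (x := -(2*β) + 1) U (by simp) z)

lemma fenchelBE_ne_top {β : ℝ} {U : ℝ → ℝ} {z : ℝ}
    (h : BddAbove ((fun x => U x - x * z) '' Set.Ioi (-(2*β)))) : fenchelBE β U z ≠ ⊤ := by
  obtain ⟨M, hM⟩ := h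
  refine ne_top_of_le_ne_top (EReal.coe_ne_top M) (iSup₂_le fun x hx => ?_)
  exact EReal.coe_le_coe_iff.2 (hM ⟨x, hx, rfl⟩)

/-- The extended-real infimum in the definition of `infConvB` is not `⊤`. -/
lemma iInf_fenchelBE_ne_top {β : ℝ} {U : ℝ → ℝ}
    (h : BddAbove ((fun x => U x - x * 1) '' Set.Ioi (-(2*β)))) (n : ℕ) (y : ℝ) :
    (⨅ z ∈ Set.Ici (0:ℝ),
      (fenchelBE β U z + (((n:ℝ)/2 * (y - z)^2 - β * z : ℝ) : EReal))) ≠ ⊤ := by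
  refine ne_top_of_le_ne_top ?_ (iInf₂_le (1 : ℝ) (Set.mem_Ici.2 zero_le_one))
  exact EReal.add_ne_top (fenchelBE_ne_top h) (EReal.coe_ne_top _)

/-- The extended-real infimum in the definition of `infConvB` is not `⊥`. -/
lemma iInf_fenchelBE_ne_bot (β : ℝ) (U : ℝ → ℝ) {n : ℕ} (hn : 1 ≤ n) (y : ℝ) :
    (⨅ z ∈ Set.Ici (0:ℝ),
      (fenchelBE β U z + (((n:ℝ)/2 * (y - z)^2 - β * z : ℝ) : EReal))) ≠ ⊥ := by
  set x : ℝ := -(2*β) + 1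
  refine ne_bot_of_le_ne_bot (EReal.coe_ne_bot (U x - (x + β) * y - (x + β)^2 / 2))
    (le_iInf₂ fun z _ => ?_)
  refine le_trans ?_ (add_le_add_left (coe_le_fenchelBE (x := x) U (by simp [x]) z) _)
  rw [← EReal.coe_add, EReal.coe_le_coe_iff]
  have hn' : (1 : ℝ) ≤ n := by exact_mod_cast hn
  nlinarith [mul_le_mul_of_nonneg_right hn' (sq_nonneg (y - z)), sq_nonneg (x + β + (y - z))]

/-- Remark 6.2 — for every `n ≥ 1`, the map `y ↦ Ũ_n(y) - 2βy` is
nonincreasing on `ℝ`. -/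
theorem remark_6_2 (β : ℝ) (hβ : 0 ≤ β) (U : ℝ → ℝ)
    (hconc : ConcaveOn ℝ (Set.Ioi (-(2*β))) U)
    (hmono : MonotoneOn U (Set.Ioi (-(2*β))))
    -- `U(∞) > 0`
    (hUpos : ∃ x ∈ Set.Ioi (-(2*β)), 0 < U x)
    -- `Ũ` is finite on `(0, ∞)`
    (hfin : ∀ y : ℝ, 0 < y → BddAbove ((fun x => U x - x * y) '' Set.Ioi (-(2*β)))) :
    ∀ n : ℕ, 1 ≤ n → Antitone (fun y => infConvB β U n y - 2*β*y) := by
  intro n hn y y' hyy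
  have hb := iInf_fenchelBE_ne_bot β U hn
  have ht := iInf_fenchelBE_ne_top (hfin 1 one_pos) n
  suffices h : (((infConvB β U n y' - β * y') - β * (y' - y) : ℝ) : EReal) ≤
      ((infConvB β U n y - β * y : ℝ) : EReal) by
    rw [EReal.coe_le_coe_iff] at h
    simp only
    linarith
  have hcoe : ∀ t : ℝ, ((infConvB β U n t - β * t : ℝ) : EReal) = _ := fun t => by
    rw [infConvB, add_sub_cancel_left, EReal.coe_toReal (ht t) (hb t)]
  rw [hcoe y]
  refine le_iInf₂ fun z hz => ?_
  have hz' : (0 : ℝ) ≤ z + (y' - y) := add_nonneg hz (sub_nonneg.2 hyy)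
  have hle := (hcoe y').le.trans (iInf₂_le (z + (y' - y)) (Set.mem_Ici.2 hz'))
  have hF := hle.trans (add_le_add_left (fenchelBE_add_le β U z (sub_nonneg.2 hyy)) _)
  have hFb := fenchelBE_ne_bot β U z
  generalize fenchelBE β U z = F at hF hFb ⊢
  induction F with
  | bot => exact absurd rfl hFb
  | top => exact le_of_le_of_eq le_top (EReal.top_add_coe _).symm
  | coe r =>
    norm_cast at hF ⊢
    nlinarith
end

section
/- Let U : ℝ → ℝ ∪ {−∞} be a nondecreasing, concave function with U(x) = −∞ for x < 0, U finite on (0, ∞), and lim_{x↓0} U(x) = −∞. Let Ũ(y) := sup_{x > 0} (U(x) − x·y) be its Fenchel transform, assumed finite on all of (0, ∞). Then lim_{y→∞} Ũ(y) = −∞ and lim_{y→∞} y / (−Ũ(y)) = +∞. -/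
/-- The Fenchel transform `Ũ(y) = sup_{x > 0} (U x - x * y)` of a utility function `U`
which equals `-∞` on `(-∞, 0)` and is finite on `(0, ∞)` (real-valued; meaningful for
`y > 0` where it is assumed finite). -/
noncomputable def fenchelP (U : ℝ → ℝ) (y : ℝ) : ℝ :=
  sSup ((fun x => U x - x * y) '' Set.Ioi (0:ℝ))

/-- The Fenchel inequality `U x - x * y ≤ Ũ y`. -/
theorem sub_mul_le_fenchelP {U : ℝ → ℝ} {x y : ℝ}
    (hfin : BddAbove ((fun x => U x - x * y) '' Set.Ioi (0:ℝ))) (hx : 0 < x) :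
    U x - x * y ≤ fenchelP U y :=
  le_csSup hfin ⟨x, hx, rfl⟩

theorem fenchelP_le {U : ℝ → ℝ} {y M : ℝ} (h : ∀ x, 0 < x → U x - x * y ≤ M) :
    fenchelP U y ≤ M := by
  refine csSup_le (Set.nonempty_Ioi.image _) ?_
  rintro _ ⟨x, hx, rfl⟩
  exact h x hx

theorem tendsto_fenchelP_atBot {U : ℝ → ℝ}
    (hbot : Filter.Tendsto U (nhdsWithin 0 (Set.Ioi 0)) Filter.atBot)
    (hfin : BddAbove ((fun x => U x - x * 1) '' Set.Ioi (0:ℝ))) :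
    Filter.Tendsto (fenchelP U) Filter.atTop Filter.atBot := by
  refine Filter.tendsto_atBot.2 fun M => ?_
  obtain ⟨δ, hδ, hδM⟩ :=
    mem_nhdsGT_iff_exists_Ioo_subset.1 (hbot.eventually (Filter.eventually_le_atBot M))
  replace hδ : 0 < δ := hδ
  filter_upwards [Filter.eventually_ge_atTop 1,
    Filter.eventually_ge_atTop (1 + (fenchelP U 1 - M) / δ)] with y hy1 hy
  refine fenchelP_le fun x hx => ?_
  rcases lt_or_ge x δ with hxδ | hxδ
  · have hUx : U x ≤ M := hδM ⟨hx, hxδ⟩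
    nlinarith
  · have hUx := sub_mul_le_fenchelP hfin hx
    have hδy : fenchelP U 1 - M ≤ (y - 1) * δ := (div_le_iff₀ hδ).1 (by linarith)
    nlinarith [mul_le_mul_of_nonneg_left hxδ (sub_nonneg.2 hy1)]

/-- Case 1, part `n = ∞`, of the proof of Lemma 6.1 — if `U(0+) = -∞`
then `Ũ(y) → -∞` as `y → ∞` and `y / (-Ũ(y)) → +∞` as `y → ∞`. -/
theorem lemma_6_1_case1_infty (U : ℝ → ℝ)
    (hconc : ConcaveOn ℝ (Set.Ioi (0:ℝ)) U)
    (hmono : MonotoneOn U (Set.Ioi (0:ℝ)))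
    -- `lim_{x ↓ 0} U(x) = -∞`
    (hbot : Filter.Tendsto U (nhdsWithin 0 (Set.Ioi 0)) Filter.atBot)
    -- `Ũ` is finite on `(0, ∞)`
    (hfin : ∀ y : ℝ, 0 < y → BddAbove ((fun x => U x - x * y) '' Set.Ioi (0:ℝ))) :
    Filter.Tendsto (fenchelP U) Filter.atTop Filter.atBot ∧
    Filter.Tendsto (fun y => y / (-(fenchelP U y))) Filter.atTop Filter.atTop := by
  have htend := tendsto_fenchelP_atBot hbot (hfin 1 one_pos)
  refine ⟨htend, Filter.tendsto_atTop.2 fun C => ?_⟩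
  set D := max C 1
  have hD : 0 < D := lt_max_of_lt_right one_pos
  filter_upwards [Filter.eventually_gt_atTop 0, htend.eventually_lt_atBot 0,
    Filter.eventually_ge_atTop (-(2 * D * U (1 / (2 * D))))] with y hy hneg hyU
  refine (le_max_left C 1).trans ((le_div_iff₀ (neg_pos.2 hneg)).2 ?_)
  have hlow := mul_le_mul_of_nonneg_left
    (sub_mul_le_fenchelP (hfin y hy) (x := 1 / (2 * D)) (by positivity)) hD.le
  have hcancel : D * (1 / (2 * D) * y) = y / 2 := by field_simp
  rw [mul_sub, hcancel] at hlow
  linarith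
end

section
/- Let U : ℝ → ℝ ∪ {−∞} be a nondecreasing, concave function with U(x) = −∞ for x < 0 and U finite on (0, ∞). Let Ũ(y) := sup_{x > 0} (U(x) − x·y) be its Fenchel transform, assumed finite on all of (0, ∞), and set Ũ(0) := sup_{x > 0} U(x). Fix an integer n ≥ 1 and y > 0, and let z* ∈ [0, ∞) be a minimizer of z ↦ Ũ(z) + (n/2)·(y − z)² over [0, ∞). Then for every x̂ > 0 such that −x̂ is a subgradient of Ũ at y (i.e., Ũ(z) ≥ Ũ(y) − x̂·(z − y) for all z > 0), one has n²·(z* − y)² ≤ 4·x̂². -/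
/-- The Fenchel transform `Ũ(z) = sup_{x > 0} (U x - x * z)` of a utility function `U`
which equals `-∞` on `(-∞, 0)` and is finite on `(0, ∞)`, with values in the extended
reals (so that `Ũ(0) = sup_{x > 0} U x`, possibly `+∞`). -/
noncomputable def fenchelPE (U : ℝ → ℝ) (z : ℝ) : EReal :=
  ⨆ x ∈ Set.Ioi (0:ℝ), ((U x - x * z : ℝ) : EReal)

/-- Where the Fenchel transform is finite, its extended-real and real versions agree. -/
theorem fenchelPE_eq_coe_fenchelP {U : ℝ → ℝ} {z : ℝ}
    (h : BddAbove ((fun x => U x - x * z) '' Set.Ioi (0:ℝ))) :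
    fenchelPE U z = (fenchelP U z : EReal) := by
  apply le_antisymm
  · refine iSup₂_le fun x hx => ?_
    exact_mod_cast le_csSup h (Set.mem_image_of_mem _ hx)
  · have hle : ∀ x ∈ Set.Ioi (0:ℝ), ((U x - x * z : ℝ) : EReal) ≤ fenchelPE U z :=
      fun x hx => le_iSup₂ (f := fun x (_ : x ∈ Set.Ioi (0:ℝ)) => ((U x - x * z : ℝ) : EReal)) x hx
    refine EReal.le_of_forall_lt_iff_le.mp fun c hc => ?_
    refine EReal.coe_le_coe_iff.mpr (csSup_le (Set.nonempty_Ioi.image _) ?_)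
    rintro _ ⟨x, hx, rfl⟩
    exact EReal.coe_le_coe_iff.mp ((hle x hx).trans hc.le)

theorem fenchelPE_antitone (U : ℝ → ℝ) : Antitone (fenchelPE U) := by
  intro a b hab
  refine iSup₂_mono fun x hx => EReal.coe_le_coe_iff.mpr ?_
  have := mul_le_mul_of_nonneg_left hab (le_of_lt (Set.mem_Ioi.mp hx))
  linarith

/-- estimate on the minimizer of the quadratic inf-convolution (Case 1,
part `n < ∞`, of the proof of Lemma 6.1) — if `z*` minimizes
`z ↦ Ũ(z) + (n/2)(y - z)²` over `[0, ∞)` and `-x̂` is a subgradient of `Ũ` at `y`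
with `x̂ > 0`, then `n² (z* - y)² ≤ 4 x̂²`. -/
theorem lemma_6_1_minimizer_bound (U : ℝ → ℝ)
    (hconc : ConcaveOn ℝ (Set.Ioi (0:ℝ)) U)
    (hmono : MonotoneOn U (Set.Ioi (0:ℝ)))
    -- `Ũ` is finite on `(0, ∞)`
    (hfin : ∀ y : ℝ, 0 < y → BddAbove ((fun x => U x - x * y) '' Set.Ioi (0:ℝ)))
    (n : ℕ) (hn : 1 ≤ n) (y : ℝ) (hy : 0 < y)
    (zstar : ℝ) (hzstar : 0 ≤ zstar)
    -- `z*` is a minimizer over `[0, ∞)` of `z ↦ Ũ(z) + (n/2)(y - z)²`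
    (hzmin : ∀ z : ℝ, 0 ≤ z →
      fenchelPE U zstar + (((n:ℝ)/2 * (y - zstar)^2 : ℝ) : EReal)
        ≤ fenchelPE U z + (((n:ℝ)/2 * (y - z)^2 : ℝ) : EReal))
    (xhat : ℝ) (hxhat : 0 < xhat)
    -- `-x̂` is a subgradient of `Ũ` at `y`
    (hsub : ∀ z : ℝ, 0 < z →
      fenchelP U y + (-xhat) * (z - y) ≤ fenchelP U z) :
    (n:ℝ)^2 * (zstar - y)^2 ≤ 4 * xhat^2 := by
  have hn' : (1:ℝ) ≤ n := by exact_mod_cast hn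
  have hmin := hzmin y hy.le
  rw [fenchelPE_eq_coe_fenchelP (hfin y hy), ← EReal.coe_add] at hmin
  rcases hzstar.eq_or_lt with rfl | hpos
  · have hle := fenchelPE_antitone U hy.le
    rw [fenchelPE_eq_coe_fenchelP (hfin y hy)] at hle
    have h := (add_le_add_left hle _).trans hmin
    rw [← EReal.coe_add, EReal.coe_le_coe_iff] at h
    have : 0 < (n:ℝ) / 2 * (y - 0) ^ 2 := by
      rw [sub_zero]
      positivity
    linarith
  · rw [fenchelPE_eq_coe_fenchelP (hfin zstar hpos), ← EReal.coe_add,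
      EReal.coe_le_coe_iff] at hmin
    have hquad : (n:ℝ) * (zstar - y) ^ 2 ≤ 2 * xhat * (zstar - y) := by
      linarith [hsub zstar hpos]
    have hd : 0 ≤ zstar - y := by
      have : 0 ≤ 2 * xhat * (zstar - y) := le_trans (by positivity) hquad
      exact nonneg_of_mul_nonneg_right this (by positivity)
    have hlin : (n:ℝ) * (zstar - y) ≤ 2 * xhat := by
      rcases hd.eq_or_lt with h0 | h0
      · rw [← h0, mul_zero]
        positivity
      · exact le_of_mul_le_mul_right (by linarith) h0
    calc (n:ℝ) ^ 2 * (zstar - y) ^ 2 = (n * (zstar - y)) ^ 2 := by ring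
      _ ≤ (2 * xhat) ^ 2 := by gcongr
      _ = 4 * xhat ^ 2 := by ring
end

section
/- Let U : ℝ → ℝ ∪ {−∞} be a nondecreasing, concave function with U(x) = −∞ for x < 0, U finite on (0, ∞), and lim_{x↓0} U(x) = −∞. Let Ũ(y) := sup_{x > 0} (U(x) − x·y) be its Fenchel transform, assumed finite on all of (0, ∞), and set Ũ(0) := sup_{x > 0} U(x). For each integer n ≥ 1 define the quadratic inf-convolution Ũ_n(y) := inf_{z ≥ 0} (Ũ(z) + (n/2)·(y − z)²) for y ∈ ℝ. Then for every n ≥ 1: lim_{y→∞} Ũ_n(y) = −∞ and lim_{y→∞} y / (−Ũ_n(y)) = +∞. -/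
/-- The quadratic inf-convolution `Ũ_n(y) := inf_{z ≥ 0} (Ũ(z) + (n/2)(y - z)²)`
(the infimum is taken in the extended reals and is in fact finite). -/
noncomputable def infConvP (U : ℝ → ℝ) (n : ℕ) (y : ℝ) : ℝ :=
  (⨅ z ∈ Set.Ici (0:ℝ), (fenchelPE U z + (((n:ℝ)/2 * (y - z)^2 : ℝ) : EReal))).toReal

theorem infConvP_lower_bound (U : ℝ → ℝ) {ε z y : ℝ} {n : ℕ} (hε : 0 < ε) (hn : 1 ≤ n) :
    ((U ε - ε * y - ε ^ 2 : ℝ) : EReal) ≤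
      fenchelPE U z + (((n : ℝ) / 2 * (y - z) ^ 2 : ℝ) : EReal) := by
  have h1 : ((U ε - ε * z : ℝ) : EReal) ≤ fenchelPE U z :=
    le_iSup₂_of_le (f := fun x (_ : x ∈ Set.Ioi (0 : ℝ)) => ((U x - x * z : ℝ) : EReal))
      ε hε le_rfl
  refine le_trans ?_ (add_le_add_left h1 _)
  rw [← EReal.coe_add, EReal.coe_le_coe_iff]
  have hn' : (1 : ℝ) ≤ n := by exact_mod_cast hn
  nlinarith [sq_nonneg (y - z + ε), mul_nonneg (sub_nonneg.2 hn') (sq_nonneg (y - z)), sq_nonneg ε]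

theorem fenchelPE_le_coe {U : ℝ → ℝ} {y b : ℝ} (h : ∀ x, 0 < x → U x - x * y ≤ b) :
    fenchelPE U y ≤ b :=
  iSup₂_le fun x hx => EReal.coe_le_coe_iff.2 (h x hx)

theorem infConvP_bounds {U : ℝ → ℝ} {y b : ℝ} {n : ℕ} (hn : 1 ≤ n) (hy : 0 ≤ y)
    (h : ∀ x, 0 < x → U x - x * y ≤ b) :
    infConvP U n y ≤ b ∧ ∀ ε, 0 < ε → U ε - ε * y - ε ^ 2 ≤ infConvP U n y := by
  have hlow (ε : ℝ) (hε : 0 < ε) := le_iInf₂ fun z (_ : z ∈ Set.Ici (0 : ℝ)) =>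
    infConvP_lower_bound U (z := z) (y := y) hε hn
  have hup : (⨅ z ∈ Set.Ici (0 : ℝ),
      (fenchelPE U z + (((n : ℝ) / 2 * (y - z) ^ 2 : ℝ) : EReal))) ≤ b :=
    iInf₂_le_of_le y hy (by simpa using fenchelPE_le_coe h)
  have htop := ne_top_of_le_ne_top (EReal.coe_ne_top b) hup
  have hbot := ne_bot_of_le_ne_bot (EReal.coe_ne_bot _) (hlow 1 one_pos)
  refine ⟨?_, fun ε hε => ?_⟩
  · exact EReal.toReal_le_toReal hup hbot (EReal.coe_ne_top b)
  · exact
      EReal.toReal_le_toReal (hlow ε hε) (EReal.coe_ne_bot _) htop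

theorem eventually_sub_mul_le {U : ℝ → ℝ}
    (hbot : Filter.Tendsto U (nhdsWithin 0 (Set.Ioi 0)) Filter.atBot)
    (hfin : BddAbove ((fun x => U x - x * 1) '' Set.Ioi (0 : ℝ))) (b : ℝ) :
    ∀ᶠ y in Filter.atTop, ∀ x, 0 < x → U x - x * y ≤ b := by
  obtain ⟨C, hC⟩ := hfin
  obtain ⟨δ, hδ, hU⟩ := mem_nhdsGT_iff_exists_Ioo_subset.1 (hbot.eventually_le_atBot b)
  have hδ : 0 < δ := hδ
  filter_upwards [Filter.eventually_ge_atTop 1,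
    Filter.eventually_ge_atTop (1 + (C - b) / δ)] with y hy1 hy x hx
  rcases lt_or_ge x δ with hlt | hge
  · have h : U x ≤ b := hU ⟨hx, hlt⟩
    nlinarith
  · have h : U x - x * 1 ≤ C := hC ⟨x, hx, rfl⟩
    have h2 : C - b ≤ (y - 1) * δ := (div_le_iff₀ hδ).1 (by linarith)
    nlinarith [mul_nonneg (sub_nonneg.2 hge) (sub_nonneg.2 hy1)]

/-- Case 1, part `n < ∞`, of the proof of Lemma 6.1 — if `U(0+) = -∞`
then for every `n ≥ 1`, `Ũ_n(y) → -∞` and `y / (-Ũ_n(y)) → +∞` as `y → ∞`. -/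
theorem lemma_6_1_case1_finite (U : ℝ → ℝ)
    (hconc : ConcaveOn ℝ (Set.Ioi (0:ℝ)) U)
    (hmono : MonotoneOn U (Set.Ioi (0:ℝ)))
    -- `lim_{x ↓ 0} U(x) = -∞`
    (hbot : Filter.Tendsto U (nhdsWithin 0 (Set.Ioi 0)) Filter.atBot)
    -- `Ũ` is finite on `(0, ∞)`
    (hfin : ∀ y : ℝ, 0 < y → BddAbove ((fun x => U x - x * y) '' Set.Ioi (0:ℝ))) :
    ∀ n : ℕ, 1 ≤ n →
      Filter.Tendsto (infConvP U n) Filter.atTop Filter.atBot ∧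
      Filter.Tendsto (fun y => y / (-(infConvP U n y))) Filter.atTop Filter.atTop := by
  intro n hn
  have hle (b : ℝ) : ∀ᶠ y in Filter.atTop, infConvP U n y ≤ b ∧
      ∀ ε, 0 < ε → U ε - ε * y - ε ^ 2 ≤ infConvP U n y := by
    filter_upwards [eventually_sub_mul_le hbot (hfin 1 one_pos) b,
      Filter.eventually_ge_atTop 0] with y hy hy0
    exact infConvP_bounds hn hy0 hy
  refine ⟨Filter.tendsto_atBot.2 fun b => (hle b).mono fun y hy => hy.1,
    Filter.tendsto_atTop.2 fun K => ?_⟩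
  obtain ⟨L, hL, hKL⟩ : ∃ L : ℝ, 0 < L ∧ K ≤ L := ⟨|K| + 1, by positivity,
    by linarith [le_abs_self K]⟩
  set ε := 1 / (2 * L) with hεdef
  have hε : 0 < ε := by positivity
  have hLε : L * ε = 1 / 2 := by rw [hεdef]; field_simp
  filter_upwards [hle (-1), Filter.eventually_ge_atTop (2 * (L * (ε ^ 2 - U ε)))] with y hy hyL
  have hpos : 0 < -infConvP U n y := by linarith [hy.1]
  refine hKL.trans ((le_div_iff₀ hpos).2 ?_)
  have h : -infConvP U n y ≤ ε ^ 2 - U ε + ε * y := by linarith [hy.2 ε hε]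
  calc L * -infConvP U n y ≤ L * (ε ^ 2 - U ε + ε * y) := by gcongr
    _ = L * (ε ^ 2 - U ε) + L * ε * y := by ring
    _ ≤ y := by rw [hLε]; linarith
end
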